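/- arXiv:2509.21726 — 3 statements merged into one kernel-verified Lean document; each statement's English description precedes it below -/
import Mathlib

section
/- Let A ∈ ℝ^{n×n}, B ∈ ℝ^{n×m}, Q ∈ ℝ^{n×n} symmetric positive semidefinite, and R ∈ ℝ^{m×m} symmetric positive definite. Suppose P ∈ ℝ^{n×n} is symmetric positive semidefinite and satisfies the algebraic Riccati equation AᵀP + PA − P B R⁻¹ Bᵀ P + Q = 0. Assume further that the pair (A, Q) is Hautus detectable, i.e., for every λ ∈ ℂ with Re(λ) ≥ 0, every w ∈ ℂⁿ with A w = λ w and Q w = 0 satisfies w = 0. Then the closed-loop matrix A − B R⁻¹ Bᵀ P is Hurwitz, i.e., every complex eigenvalue of A − B R⁻¹ Bᵀ P has negative real part. -/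
open Matrix

open scoped ComplexOrder MatrixOrder in
/-- The complexification of a real positive semidefinite matrix is positive semidefinite. -/
theorem Matrix.PosSemidef.map_algebraMap_complex {n : Type*} [Fintype n]
    {M : Matrix n n ℝ} (hM : M.PosSemidef) : (M.map (algebraMap ℝ ℂ)).PosSemidef := by
  classical
  obtain ⟨C, rfl⟩ := CStarAlgebra.nonneg_iff_eq_star_mul_self.mp hM.nonneg
  have h : (star C * C).map (algebraMap ℝ ℂ)
      = (C.map (algebraMap ℝ ℂ))ᴴ * C.map (algebraMap ℝ ℂ) := by
    rw [Matrix.map_mul]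
    congr 1
    ext i j
    simp [Matrix.star_eq_conjTranspose]
  rw [h]
  exact posSemidef_conjTranspose_mul_self _

open scoped ComplexOrder in
/-- An eigenvector of the closed-loop matrix of a positive semidefinite Riccati solution whose
eigenvalue has nonnegative real part is an unobservable eigenvector of the open loop. -/
theorem riccati_eigenvector_unobservable {n m : Type*} [Fintype n] [Fintype m]
    {A P Q : Matrix n n ℂ} {B : Matrix n m ℂ} {T : Matrix m m ℂ}
    (hP : P.PosSemidef) (hQ : Q.PosSemidef) (hT : T.PosSemidef)
    (hric : Aᴴ * P + P * A - P * B * T * Bᴴ * P + Q = 0)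
    {μ : ℂ} (hμ : 0 ≤ μ.re) {w : n → ℂ} (hw : (A - B * T * Bᴴ * P) *ᵥ w = μ • w) :
    A *ᵥ w = μ • w ∧ Q *ᵥ w = 0 := by
  set F := A - B * T * Bᴴ * P with hF
  have hlyap : Fᴴ * P + P * F + (Bᴴ * P)ᴴ * T * (Bᴴ * P) + Q = 0 := by
    rw [← hric, hF]
    simp only [conjTranspose_sub, conjTranspose_mul, conjTranspose_conjTranspose,
      hP.isHermitian.eq, hT.isHermitian.eq, Matrix.sub_mul, Matrix.mul_sub, Matrix.mul_assoc]
    abel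
  have hquad : star μ * (star w ⬝ᵥ P *ᵥ w) + μ * (star w ⬝ᵥ P *ᵥ w)
      + star ((Bᴴ * P) *ᵥ w) ⬝ᵥ T *ᵥ ((Bᴴ * P) *ᵥ w) + star w ⬝ᵥ Q *ᵥ w = 0 := by
    have h := congrArg (fun M => star w ⬝ᵥ M *ᵥ w) hlyap
    have h1 : star w ⬝ᵥ (Fᴴ * P) *ᵥ w = star μ * (star w ⬝ᵥ P *ᵥ w) := by
      rw [← mulVec_mulVec, dotProduct_mulVec, ← star_mulVec, hw, star_smul, smul_dotProduct,
        smul_eq_mul]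
    have h2 : star w ⬝ᵥ (P * F) *ᵥ w = μ * (star w ⬝ᵥ P *ᵥ w) := by
      rw [← mulVec_mulVec, hw, mulVec_smul, dotProduct_smul, smul_eq_mul]
    have h3 : star w ⬝ᵥ ((Bᴴ * P)ᴴ * T * (Bᴴ * P)) *ᵥ w
        = star ((Bᴴ * P) *ᵥ w) ⬝ᵥ T *ᵥ ((Bᴴ * P) *ᵥ w) := by
      rw [Matrix.mul_assoc, ← mulVec_mulVec, dotProduct_mulVec, ← star_mulVec,
        ← mulVec_mulVec _ T]
    simpa only [add_mulVec, dotProduct_add, h1, h2, h3, zero_mulVec, dotProduct_zero] using h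
  have hp := hP.dotProduct_mulVec_nonneg w
  have ht := hT.dotProduct_mulVec_nonneg ((Bᴴ * P) *ᵥ w)
  have hq := hQ.dotProduct_mulVec_nonneg w
  have hμp : 0 ≤ star μ * (star w ⬝ᵥ P *ᵥ w) + μ * (star w ⬝ᵥ P *ᵥ w) := by
    rw [← add_mul]
    refine mul_nonneg ?_ hp
    rw [add_comm, Complex.star_def, Complex.add_conj]
    exact_mod_cast mul_nonneg zero_le_two hμ
  obtain ⟨hsum, hq0⟩ := (add_eq_zero_iff_of_nonneg (add_nonneg hμp ht) hq).mp hquad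
  have ht0 := ((add_eq_zero_iff_of_nonneg hμp ht).mp hsum).2
  have hTz := (hT.dotProduct_mulVec_zero_iff _).mp ht0
  refine ⟨?_, (hQ.dotProduct_mulVec_zero_iff w).mp hq0⟩
  have hBz : (B * T * Bᴴ * P) *ᵥ w = 0 := by
    rw [Matrix.mul_assoc (B * T), ← mulVec_mulVec, ← mulVec_mulVec, hTz, mulVec_zero]
  rw [← hw, hF, sub_mulVec, hBz, sub_zero]

/-- Closed-loop stability of a Riccati solution: if `P ⪰ 0` solves the algebraic Riccati
equation and `(A, Q)` is Hautus detectable, then `A − B R⁻¹ Bᵀ P` is Hurwitz. -/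
theorem stmt9 (n m : ℕ) (A : Matrix (Fin n) (Fin n) ℝ) (B : Matrix (Fin n) (Fin m) ℝ)
    (Q : Matrix (Fin n) (Fin n) ℝ) (R : Matrix (Fin m) (Fin m) ℝ)
    (hQ : Q.PosSemidef) (hR : R.PosDef)
    (P : Matrix (Fin n) (Fin n) ℝ) (hP : P.PosSemidef)
    (hric : Aᵀ * P + P * A - P * B * R⁻¹ * Bᵀ * P + Q = 0)
    (hdet : ∀ lam : ℂ, 0 ≤ lam.re → ∀ w : Fin n → ℂ,
      (A.map (algebraMap ℝ ℂ)).mulVec w = lam • w →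
      (Q.map (algebraMap ℝ ℂ)).mulVec w = 0 → w = 0) :
    ∀ μ : ℂ, ((A - B * R⁻¹ * Bᵀ * P).charpoly.map (algebraMap ℝ ℂ)).IsRoot μ → μ.re < 0 := by
  intro μ hroot
  by_contra! hμ
  rw [← charpoly_map, Polynomial.IsRoot, eval_charpoly] at hroot
  obtain ⟨w, hw0, hw⟩ := exists_mulVec_eq_zero_iff.mpr hroot
  have hadj {k l : ℕ} (M : Matrix (Fin k) (Fin l) ℝ) :
      Mᵀ.map (algebraMap ℝ ℂ) = (M.map (algebraMap ℝ ℂ))ᴴ := by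
    ext i j
    simp
  have hadd (M N : Matrix (Fin n) (Fin n) ℝ) : (M + N).map (algebraMap ℝ ℂ)
      = M.map (algebraMap ℝ ℂ) + N.map (algebraMap ℝ ℂ) := Matrix.map_add _ (map_add _) M N
  have hsub (M N : Matrix (Fin n) (Fin n) ℝ) : (M - N).map (algebraMap ℝ ℂ)
      = M.map (algebraMap ℝ ℂ) - N.map (algebraMap ℝ ℂ) := Matrix.map_sub _ (map_sub _) M N
  rw [sub_mulVec, sub_eq_zero, scalar_apply, ← smul_one_eq_diagonal, smul_mulVec, one_mulVec]
    at hw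
  have hricC := congrArg (fun M => M.map (algebraMap ℝ ℂ)) hric
  simp only [hadd, hsub, Matrix.map_mul, hadj,
    Matrix.map_zero _ (map_zero (algebraMap ℝ ℂ))] at hricC hw
  obtain ⟨hA, hQw⟩ := riccati_eigenvector_unobservable hP.map_algebraMap_complex
    hQ.map_algebraMap_complex hR.posSemidef.inv.map_algebraMap_complex hricC hμ hw.symm
  exact hw0 (hdet μ hμ w hA hQw)
end

section
/- Let n, n_d, m ∈ ℕ, γ ∈ ℝ, A ∈ ℝ^{n×n}, A_d ∈ ℝ^{n_d×n_d}, g ∈ ℝ^{n×m}, α ∈ ℝ^n, R ∈ ℝ^{m×m} symmetric positive definite, and Q₁ ∈ ℝ^{(n+n_d)×(n+n_d)} symmetric. Set Ā = blkdiag(A − γI_n, A_d − γI_{n_d}) ∈ ℝ^{(n+n_d)×(n+n_d)} and Ḡ = [g; 0] ∈ ℝ^{(n+n_d)×m}. Suppose P̄ ∈ ℝ^{(n+n_d)×(n+n_d)} is symmetric and satisfies ĀᵀP̄ + P̄Ā − P̄ Ḡ R⁻¹ Ḡᵀ P̄ + Q₁ = 0. Define the augmented matrices A_z = [[Ā, 0],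 [ᾱᵀ, −γ]] ∈ ℝ^{(n+n_d+1)×(n+n_d+1)} with ᾱ = [α; 0] ∈ ℝ^{n+n_d}, G_z = [Ḡ; 0] ∈ ℝ^{(n+n_d+1)×m} (i.e., barrier-state input coefficient β = 0), and Q_z = blkdiag(Q₁, 0) (i.e., barrier weight q_z = 0). Then P_z := blkdiag(P̄, 0) satisfies the augmented Riccati equation A_zᵀP_z + P_zA_z − P_z G_z R⁻¹ G_zᵀ P_z + Q_z = 0, and the feedback gain K_z := R⁻¹ G_zᵀ P_z ∈ ℝ^{m×(n+n_d+1)} has its last column equal to zero, so the resulting control law is independent of the barrier state. -/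
open Matrix

/-- Extending a matrix by a zero block and an input matrix by zero rows leaves only the
original product. -/
theorem fromBlocks_zero_mul_fromRows_zero {ι κ μ 𝕜 : Type*} [Fintype ι] [Fintype κ] [Semiring 𝕜]
    (P : Matrix ι ι 𝕜) (G : Matrix ι μ 𝕜) :
    Matrix.fromBlocks P 0 0 (0 : Matrix κ κ 𝕜) * Matrix.fromRows G (0 : Matrix κ μ 𝕜) =
      Matrix.fromRows (P * G) 0 := by
  simp [Matrix.fromBlocks_mul_fromRows]

/-- The transposed counterpart of `fromBlocks_zero_mul_fromRows_zero`. -/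
theorem fromRows_zero_transpose_mul_fromBlocks_zero {ι κ μ 𝕜 : Type*} [Fintype ι] [Fintype κ]
    [Semiring 𝕜] (P : Matrix ι ι 𝕜) (G : Matrix ι μ 𝕜) :
    (Matrix.fromRows G (0 : Matrix κ μ 𝕜))ᵀ * Matrix.fromBlocks P 0 0 (0 : Matrix κ κ 𝕜) =
      Matrix.fromCols (Gᵀ * P) 0 := by
  simp [Matrix.transpose_fromRows, Matrix.fromCols_mul_fromBlocks]

/-- Remark 3 of the paper: with barrier-input coefficient `β = 0` and barrier weight
`q_z = 0`, the block-diagonal extension `P_z = blkdiag(P̄, 0)` of a Riccati solution `P̄`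
solves the augmented Riccati equation, and the feedback gain `K_z = R⁻¹ G_zᵀ P_z` has zero
last column, so the control law is independent of the barrier state. -/
theorem stmt12 (n nd m : ℕ) (γ : ℝ)
    (A : Matrix (Fin n) (Fin n) ℝ) (Ad : Matrix (Fin nd) (Fin nd) ℝ)
    (g : Matrix (Fin n) (Fin m) ℝ) (α : Fin n → ℝ)
    (R : Matrix (Fin m) (Fin m) ℝ) (hR : R.PosDef)
    (Q₁ : Matrix (Fin n ⊕ Fin nd) (Fin n ⊕ Fin nd) ℝ) (hQ₁ : Q₁.IsSymm)
    (Pbar : Matrix (Fin n ⊕ Fin nd) (Fin n ⊕ Fin nd) ℝ) (hPbar : Pbar.IsSymm)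
    (hric : (Matrix.fromBlocks (A - γ • 1) 0 0 (Ad - γ • 1))ᵀ * Pbar +
        Pbar * Matrix.fromBlocks (A - γ • 1) 0 0 (Ad - γ • 1) -
        Pbar * Matrix.fromRows g (0 : Matrix (Fin nd) (Fin m) ℝ) * R⁻¹ *
          (Matrix.fromRows g (0 : Matrix (Fin nd) (Fin m) ℝ))ᵀ * Pbar + Q₁ = 0) :
    let Az : Matrix ((Fin n ⊕ Fin nd) ⊕ Fin 1) ((Fin n ⊕ Fin nd) ⊕ Fin 1) ℝ :=
      Matrix.fromBlocks (Matrix.fromBlocks (A - γ • 1) 0 0 (Ad - γ • 1)) 0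
        (Matrix.of fun (_ : Fin 1) (j : Fin n ⊕ Fin nd) => Sum.elim α (fun _ => (0 : ℝ)) j)
        (Matrix.of fun (_ : Fin 1) (_ : Fin 1) => -γ)
    let Gz : Matrix ((Fin n ⊕ Fin nd) ⊕ Fin 1) (Fin m) ℝ :=
      Matrix.fromRows (Matrix.fromRows g (0 : Matrix (Fin nd) (Fin m) ℝ))
        (0 : Matrix (Fin 1) (Fin m) ℝ)
    let Qz : Matrix ((Fin n ⊕ Fin nd) ⊕ Fin 1) ((Fin n ⊕ Fin nd) ⊕ Fin 1) ℝ :=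
      Matrix.fromBlocks Q₁ 0 0 (0 : Matrix (Fin 1) (Fin 1) ℝ)
    let Pz : Matrix ((Fin n ⊕ Fin nd) ⊕ Fin 1) ((Fin n ⊕ Fin nd) ⊕ Fin 1) ℝ :=
      Matrix.fromBlocks Pbar 0 0 (0 : Matrix (Fin 1) (Fin 1) ℝ)
    Azᵀ * Pz + Pz * Az - Pz * Gz * R⁻¹ * Gzᵀ * Pz + Qz = 0 ∧
      ∀ i : Fin m, (R⁻¹ * Gzᵀ * Pz) i (Sum.inr (0 : Fin 1)) = 0 := by
  intro Az Gz Qz Pz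
  have hPG := fromBlocks_zero_mul_fromRows_zero (κ := Fin 1) Pbar
    (Matrix.fromRows g (0 : Matrix (Fin nd) (Fin m) ℝ))
  have hGP := fromRows_zero_transpose_mul_fromBlocks_zero (κ := Fin 1) Pbar
    (Matrix.fromRows g (0 : Matrix (Fin nd) (Fin m) ℝ))
  constructor
  · rw [Matrix.mul_assoc _ Gzᵀ Pz, hPG, hGP, Matrix.fromRows_mul, Matrix.fromRows_mul_fromCols,
      Matrix.fromBlocks_transpose, Matrix.fromBlocks_multiply, Matrix.fromBlocks_multiply,
      Matrix.fromBlocks_add, sub_eq_add_neg, Matrix.fromBlocks_neg, Matrix.fromBlocks_add,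
      Matrix.fromBlocks_add]
    simp only [Matrix.mul_zero, Matrix.zero_mul, Matrix.transpose_zero, add_zero, neg_zero,
      ← Matrix.mul_assoc, ← sub_eq_add_neg]
    rw [hric, Matrix.fromBlocks_zero]
  · intro i
    rw [Matrix.mul_assoc, hGP, Matrix.mul_fromCols, Matrix.mul_zero]
    rfl
end

section
/- Let T > 0, let x : [0, T] → ℝⁿ be continuous, let s : ℝⁿ → ℝ be continuous, let q : ℝ → ℝ satisfy q(0) = 0, let p : ℝⁿ → ℝ, and let z : [0, T] → ℝ. Assume: (i) z(t) · q(s(x(t))) = p(x(t)) for all t ∈ [0, T]; (ii) there exist constants M > 0 and δ > 0 with |z(t)| ≤ M and |p(x(t))| ≥ δ for all t ∈ [0, T]; and (iii) s(x(0)) > 0. Then s(x(t)) > 0 for all t ∈ [0, T]. -/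
/-- Safety mechanism of the barrier state: if `z(t) q(s(x(t))) = p(x(t))` along a continuous
trajectory, `z` is bounded, `|p(x(t))| ≥ δ > 0`, `q(0) = 0`, and `s(x(0)) > 0`, then
`s(x(t)) > 0` for all `t ∈ [0, T]`. -/
theorem stmt16 (n : ℕ) (T : ℝ) (hT : 0 < T)
    (x : ℝ → Fin n → ℝ) (hx : ContinuousOn x (Set.Icc 0 T))
    (s : (Fin n → ℝ) → ℝ) (hs : Continuous s)
    (q : ℝ → ℝ) (hq0 : q 0 = 0)
    (p : (Fin n → ℝ) → ℝ) (z : ℝ → ℝ)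
    (hzq : ∀ t ∈ Set.Icc (0 : ℝ) T, z t * q (s (x t)) = p (x t))
    (M δ : ℝ) (hM : 0 < M) (hδ : 0 < δ)
    (hzb : ∀ t ∈ Set.Icc (0 : ℝ) T, |z t| ≤ M)
    (hpb : ∀ t ∈ Set.Icc (0 : ℝ) T, δ ≤ |p (x t)|)
    (h0 : 0 < s (x 0)) :
    ∀ t ∈ Set.Icc (0 : ℝ) T, 0 < s (x t) := by
  intro t ht
  by_contra! hst
  have hcont : ContinuousOn (fun r => s (x r)) (Set.Icc 0 t) :=
    hs.comp_continuousOn (hx.mono (Set.Icc_subset_Icc_right ht.2))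
  obtain ⟨r, hr, hsr⟩ := intermediate_value_Icc' ht.1 hcont ⟨hst, h0.le⟩
  have hr' : r ∈ Set.Icc 0 T := Set.Icc_subset_Icc_right ht.2 hr
  have hpr : p (x r) = 0 := by
    rw [← hzq r hr', show s (x r) = 0 from hsr, hq0, mul_zero]
  have hle := hpb r hr'
  rw [hpr, abs_zero] at hle
  exact hδ.not_ge hle
end
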